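/- Let (R,m) be a Noetherian local ring or a standard graded K-algebra with graded maximal ideal m, and let S = R[y_1,…,y_m] be graded by deg a = 0 for a ∈ R \ {0} and deg y_j = 1, so that each graded component of a finitely generated graded S-module is a finitely generated R-module. If N ⊆ M are finitely generated graded S-modules, then the Artin-Rees number ρ(N_k, M_k) of the degree-k components is constant for all sufficiently large k. -/

import Mathlib

open Submodule IsLocalRing MvPolynomial

/-- The Artin–Rees number `ρ(N, P)` of a pair of submodules `N, P` of an `R`-module with
respect to an ideal `m`: the smallest `r` such that `N ∩ m^i P = m^{i-r} (N ∩ m^r P)`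
for all `i ≥ r`. -/
noncomputable def artinReesNumber {R : Type*} [CommRing R] {M : Type*} [AddCommGroup M]
    [Module R M] (m : Ideal R) (N P : Submodule R M) : ℕ :=
  sInf {r : ℕ | ∀ i : ℕ, r ≤ i → N ⊓ m ^ i • P = m ^ (i - r) • (N ⊓ m ^ r • P)}

theorem artinReesNumber_eq_sInf {R : Type*} [CommRing R] {M : Type*} [AddCommGroup M]
    [Module R M] (m : Ideal R) (N P : Submodule R M) :
    artinReesNumber m N P =
      sInf {r : ℕ | ∀ i : ℕ, r ≤ i → N ⊓ m ^ (i + 1) • P ≤ m • (N ⊓ m ^ i • P)} := by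
  have hle (i : ℕ) : m • (N ⊓ m ^ i • P) ≤ N ⊓ m ^ (i + 1) • P := by
    refine le_inf (smul_le_right.trans inf_le_left) ?_
    rw [pow_succ', Submodule.mul_smul]
    exact smul_mono_right _ inf_le_right
  unfold artinReesNumber
  congr 1
  ext r
  simp only [Set.mem_ofPred_eq]
  constructor
  · intro h i hi
    rw [h (i + 1) (by omega), h i hi, ← Submodule.mul_smul, ← pow_succ', Nat.sub_add_comm hi]
  · intro h i hi
    induction i, hi using Nat.le_induction with
    | base => simp
    | succ i hi ih =>
      rw [(h i hi).antisymm (hle i), ih, ← Submodule.mul_smul, ← pow_succ', Nat.sub_add_comm hi]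

/-- The projection of a decomposed module onto its degree-`k` component. -/
noncomputable def decomposeProj {R M : Type*} [CommRing R] [AddCommGroup M] [Module R M]
    (ℳ : ℕ → Submodule R M) [DirectSum.Decomposition ℳ] (k : ℕ) : M →ₗ[R] M :=
  (ℳ k).subtype ∘ₗ DirectSum.component R ℕ (fun i => ℳ i) k ∘ₗ
    (DirectSum.decomposeLinearEquiv ℳ).toLinearMap

section Graded

variable {R M : Type*} [CommRing R] [AddCommGroup M] [Module R M]
  (ℳ : ℕ → Submodule R M) [DirectSum.Decomposition ℳ]

theorem decompose_mem_smul_inf (J : Ideal R) (P : Submodule R M)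
    (hP : ∀ x ∈ P, ∀ k : ℕ, (DirectSum.decompose ℳ x k : M) ∈ P) {x : M} (hx : x ∈ J • P)
    (k : ℕ) : (DirectSum.decompose ℳ x k : M) ∈ J • (P ⊓ ℳ k) := by
  have h := Submodule.mem_map_of_mem (f := decomposeProj ℳ k) hx
  rw [Submodule.map_smul''] at h
  refine Submodule.smul_mono le_rfl ?_ h
  rintro _ ⟨y, hy, rfl⟩
  exact ⟨hP y hy k, SetLike.coe_mem _⟩

theorem smul_inf_component (J : Ideal R) (P : Submodule R M)
    (hP : ∀ x ∈ P, ∀ k : ℕ, (DirectSum.decompose ℳ x k : M) ∈ P) (k : ℕ) :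
    J • P ⊓ ℳ k = J • (P ⊓ ℳ k) := by
  refine le_antisymm ?_ (le_inf (smul_mono_right J inf_le_left) (smul_le_right.trans inf_le_right))
  rintro x ⟨hx, hxk⟩
  have h := decompose_mem_smul_inf ℳ J P hP hx k
  rwa [DirectSum.decompose_of_mem_same ℳ hxk] at h

end Graded

theorem exists_add_eq_of_le_degree {σ : Type*} (e : σ →₀ ℕ) {n : ℕ} (hn : n ≤ e.degree) :
    ∃ a b : σ →₀ ℕ, a + b = e ∧ a.degree = n := by
  induction n with
  | zero => exact ⟨0, e, by simp, by simp⟩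
  | succ n ih =>
    obtain ⟨a, b, hab, ha⟩ := ih (by omega)
    have hb : b ≠ 0 := by
      rintro rfl
      rw [add_zero] at hab
      subst hab
      omega
    obtain ⟨i, hi⟩ := Finsupp.ne_iff.mp hb
    have hle : Finsupp.single i 1 ≤ b := by
      rw [Finsupp.single_le_iff]
      exact Nat.one_le_iff_ne_zero.mpr hi
    refine ⟨a + Finsupp.single i 1, b - Finsupp.single i 1, ?_, ?_⟩
    · rw [add_assoc, add_tsub_cancel_of_le hle, hab]
    · simp [ha]

section Polynomial

variable {R σ M : Type*} [CommRing R] [AddCommGroup M]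
  [Module (MvPolynomial σ R) M] [Module R M]
  (ℳ : ℕ → Submodule R M)

theorem monomial_smul_mem_of_component_le
    (hcompat : ∀ (p : ℕ) (a : MvPolynomial σ R), a ∈ homogeneousSubmodule σ R p →
      ∀ (k : ℕ) (w : M), w ∈ ℳ k → a • w ∈ ℳ (p + k))
    {A B : Submodule (MvPolynomial σ R) M} {k : ℕ} (hk : ∀ x ∈ A, x ∈ ℳ k → x ∈ B)
    {d : ℕ} (hd : d ≤ k) {g : M} (hgA : g ∈ A) (hg : g ∈ ℳ d) (e : σ →₀ ℕ) (c : R)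
    (he : k ≤ e.degree + d) : monomial e c • g ∈ B := by
  obtain ⟨a, b, rfl, ha⟩ := exists_add_eq_of_le_degree e (n := k - d) (by omega)
  have hmul : (monomial (a + b) c : MvPolynomial σ R) = monomial b c * monomial a 1 := by
    rw [monomial_mul, add_comm, mul_one]
  rw [hmul, mul_smul]
  refine B.smul_mem _ (hk _ (A.smul_mem _ hgA) ?_)
  have h := hcompat (k - d) (monomial a 1)
    ((mem_homogeneousSubmodule _ _).mpr (isHomogeneous_monomial _ ha)) d g hg
  rwa [Nat.sub_add_cancel hd] at h

variable [DirectSum.Decomposition ℳ]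

theorem decompose_smul_mem_of_component_le
    (hcompat : ∀ (p : ℕ) (a : MvPolynomial σ R), a ∈ homogeneousSubmodule σ R p →
      ∀ (k : ℕ) (w : M), w ∈ ℳ k → a • w ∈ ℳ (p + k))
    {A B : Submodule (MvPolynomial σ R) M} {k : ℕ} (hk : ∀ x ∈ A, x ∈ ℳ k → x ∈ B)
    {d : ℕ} (hd : d ≤ k) {g : M} (hgA : g ∈ A) (hg : g ∈ ℳ d) (s : MvPolynomial σ R)
    {l : ℕ} (hl : k ≤ l) : (DirectSum.decompose ℳ (s • g) l : M) ∈ B := by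
  induction s using MvPolynomial.induction_on' with
  | monomial e c =>
    have h := hcompat e.degree (monomial e c)
      ((mem_homogeneousSubmodule _ _).mpr (isHomogeneous_monomial _ rfl)) d g hg
    by_cases hel : e.degree + d = l
    · subst hel
      rw [DirectSum.decompose_of_mem_same ℳ h]
      exact monomial_smul_mem_of_component_le ℳ hcompat hk hd hgA hg e c hl
    · rw [DirectSum.decompose_of_mem_ne ℳ h hel]
      exact B.zero_mem
  | add p q hp hq =>
    rw [add_smul, DirectSum.decompose_add]
    exact B.add_mem hp hq

/-- If a finitely generated graded submodule `A` is contained in `B` in one sufficiently high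
degree, then it is so in all higher degrees. -/
theorem exists_forall_component_le
    (hcompat : ∀ (p : ℕ) (a : MvPolynomial σ R), a ∈ homogeneousSubmodule σ R p →
      ∀ (k : ℕ) (w : M), w ∈ ℳ k → a • w ∈ ℳ (p + k))
    {A : Submodule (MvPolynomial σ R) M} (hfg : A.FG)
    (hA : ∀ x ∈ A, ∀ k : ℕ, (DirectSum.decompose ℳ x k : M) ∈ A) :
    ∃ D : ℕ, ∀ (B : Submodule (MvPolynomial σ R) M) (k : ℕ), D ≤ k →
      (∀ x ∈ A, x ∈ ℳ k → x ∈ B) → ∀ l, k ≤ l → ∀ x ∈ A, x ∈ ℳ l → x ∈ B := by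
  classical
  obtain ⟨G, rfl⟩ := hfg
  refine ⟨G.sup fun g => (DirectSum.decompose ℳ g).support.sup id, ?_⟩
  intro B k hDk hk l hl x hx hxl
  suffices h : ∀ s : MvPolynomial σ R, (DirectSum.decompose ℳ (s • x) l : M) ∈ B by
    have h1 := h 1
    rwa [one_smul, DirectSum.decompose_of_mem_same ℳ hxl] at h1
  clear hxl
  induction hx using Submodule.span_induction with
  | mem g hg =>
    intro s
    rw [← DirectSum.sum_support_decompose ℳ g, Finset.smul_sum, DirectSum.decompose_sum,
      DFinsupp.finsetSum_apply, AddSubmonoidClass.coe_finsetSum]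
    refine B.sum_mem fun d hd => ?_
    refine decompose_smul_mem_of_component_le ℳ hcompat hk (le_trans ?_ hDk)
      (hA g (Submodule.subset_span hg) d) (SetLike.coe_mem _) s hl
    exact (Finset.le_sup (f := id) hd).trans
      (Finset.le_sup (f := fun g => (DirectSum.decompose ℳ g).support.sup id) hg)
  | zero => intro s; simp
  | add x y _ _ hx hy =>
    intro s
    rw [smul_add, DirectSum.decompose_add]
    exact B.add_mem (hx s) (hy s)
  | smul t x _ hx =>
    intro s
    rw [← mul_smul]
    exact hx _

theorem eventually_component_le_iff
    (hcompat : ∀ (p : ℕ) (a : MvPolynomial σ R), a ∈ homogeneousSubmodule σ R p →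
      ∀ (k : ℕ) (w : M), w ∈ ℳ k → a • w ∈ ℳ (p + k))
    {A : Submodule (MvPolynomial σ R) M} (hfg : A.FG)
    (hA : ∀ x ∈ A, ∀ k : ℕ, (DirectSum.decompose ℳ x k : M) ∈ A)
    (B : Submodule (MvPolynomial σ R) M) :
    ∃ b : Prop, ∀ᶠ k in Filter.atTop, (∀ x ∈ A, x ∈ ℳ k → x ∈ B) ↔ b := by
  obtain ⟨D, hD⟩ := exists_forall_component_le ℳ hcompat hfg hA
  by_cases h : ∃ k, D ≤ k ∧ ∀ x ∈ A, x ∈ ℳ k → x ∈ B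
  · obtain ⟨k, hDk, hk⟩ := h
    exact ⟨True, Filter.eventually_atTop.mpr ⟨k, fun l hl => iff_true_intro (hD B k hDk hk l hl)⟩⟩
  · push Not at h
    refine ⟨False, Filter.eventually_atTop.mpr ⟨D, fun k hk => iff_false_intro fun hle => ?_⟩⟩
    obtain ⟨x, hxA, hxk, hxB⟩ := h k hk
    exact hxB (hle x hxA hxk)

end Polynomial

/-- The Artin–Rees lemma, in one-step form. -/
theorem exists_inf_pow_succ_smul_le {S M : Type*} [CommRing S] [IsNoetherianRing S]
    [AddCommGroup M] [Module S M] [Module.Finite S M] (I : Ideal S) (N : Submodule S M) :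
    ∃ r : ℕ, ∀ i, r ≤ i →
      N ⊓ I ^ (i + 1) • (⊤ : Submodule S M) ≤ I • (N ⊓ I ^ i • (⊤ : Submodule S M)) := by
  obtain ⟨r, hr⟩ := I.exists_pow_inf_eq_pow_smul N
  refine ⟨r, fun i hi => ?_⟩
  rw [inf_comm, inf_comm N, hr (i + 1) (by omega), hr i hi, ← Submodule.mul_smul, ← pow_succ',
    Nat.sub_add_comm hi]

/-- Let `(R, m)` be a Noetherian local ring and `S = R[y_1, …, y_m]` the
polynomial ring, graded with `deg a = 0` for `a ∈ R` and `deg y_j = 1` (so the degree-`j`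
piece of `S` is `homogeneousSubmodule (Fin m) R j`, the homogeneous polynomials of total
degree `j`, an `R`-submodule).  If `N ⊆ M` are finitely generated graded `S`-modules
(with grading `ℳ : ℕ → Submodule R M` compatible with that of `S`, and `N` a graded
submodule), then the Artin–Rees number `ρ(N_k, M_k)` of the degree-`k` components is
constant for all sufficiently large `k`. -/
theorem statement7 {R : Type*} [CommRing R] [IsNoetherianRing R] [IsLocalRing R] (m : ℕ)
    (M : Type*) [AddCommGroup M]
    [Module (MvPolynomial (Fin m) R) M] [Module R M]
    [IsScalarTower R (MvPolynomial (Fin m) R) M]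
    [Module.Finite (MvPolynomial (Fin m) R) M]
    (ℳ : ℕ → Submodule R M) [DirectSum.Decomposition ℳ]
    (hcompat : ∀ (p : ℕ) (a : MvPolynomial (Fin m) R),
      a ∈ homogeneousSubmodule (Fin m) R p →
      ∀ (k : ℕ) (w : M), w ∈ ℳ k → a • w ∈ ℳ (p + k))
    (N : Submodule (MvPolynomial (Fin m) R) M)
    (hNgraded : ∀ x ∈ N, ∀ k : ℕ, (DirectSum.decompose ℳ x k : M) ∈ N) :
    ∃ r c : ℕ, ∀ k : ℕ, r ≤ k →
      artinReesNumber (maximalIdeal R)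
        (N.restrictScalars R ⊓ ℳ k) (ℳ k) = c := by
  set 𝔪 := maximalIdeal R
  set I : Ideal (MvPolynomial (Fin m) R) := 𝔪.map (algebraMap R (MvPolynomial (Fin m) R)) with hI
  let L : ℕ → Submodule (MvPolynomial (Fin m) R) M := fun i => N ⊓ I ^ i • ⊤
  have hpow (i : ℕ) : (I ^ i • (⊤ : Submodule (MvPolynomial (Fin m) R) M)).restrictScalars R =
      𝔪 ^ i • ⊤ := by
    rw [hI, ← Ideal.map_pow, Ideal.smul_restrictScalars, Submodule.restrictScalars_top]
  have hLR (i : ℕ) : (L i).restrictScalars R = N.restrictScalars R ⊓ 𝔪 ^ i • ⊤ := by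
    rw [← hpow i]
    rfl
  have hLk (i k : ℕ) : (L i).restrictScalars R ⊓ ℳ k =
      N.restrictScalars R ⊓ ℳ k ⊓ 𝔪 ^ i • ℳ k := by
    have h := smul_inf_component ℳ (𝔪 ^ i) ⊤ (fun _ _ _ => Submodule.mem_top) k
    rw [top_inf_eq] at h
    rw [hLR, ← h, inf_assoc, inf_assoc, ← inf_assoc (ℳ k), inf_comm (ℳ k), inf_assoc, inf_idem]
  have hLgr (i : ℕ) : ∀ x ∈ L i, ∀ k : ℕ, (DirectSum.decompose ℳ x k : M) ∈ L i := by
    intro x hx k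
    refine ⟨hNgraded x hx.1 k, ?_⟩
    have hx2 : x ∈ (I ^ i • (⊤ : Submodule (MvPolynomial (Fin m) R) M)).restrictScalars R := hx.2
    suffices h : (DirectSum.decompose ℳ x k : M) ∈
        (I ^ i • (⊤ : Submodule (MvPolynomial (Fin m) R) M)).restrictScalars R from h
    rw [hpow] at hx2 ⊢
    exact Submodule.smul_mono le_rfl inf_le_left
      (decompose_mem_smul_inf ℳ (𝔪 ^ i) ⊤ (fun _ _ _ => Submodule.mem_top) hx2 k)
  have hiff (i k : ℕ) : N.restrictScalars R ⊓ ℳ k ⊓ 𝔪 ^ (i + 1) • ℳ k ≤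
      𝔪 • (N.restrictScalars R ⊓ ℳ k ⊓ 𝔪 ^ i • ℳ k) ↔
      ∀ x ∈ L (i + 1), x ∈ ℳ k → x ∈ I • L i := by
    rw [← hLk, ← hLk, ← smul_inf_component ℳ 𝔪 _ (hLgr i) k, ← Ideal.smul_restrictScalars]
    exact ⟨fun h x hx hxk => (h ⟨hx, hxk⟩).1, fun h x hx => ⟨h x hx.1 hx.2, hx.2⟩⟩
  obtain ⟨r, hr⟩ := exists_inf_pow_succ_smul_le I N
  choose b hb using fun i => eventually_component_le_iff ℳ hcompat
    (IsNoetherian.noetherian (L (i + 1))) (hLgr (i + 1)) (I • L i)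
  have hall := (Filter.eventually_all_finite (Set.finite_Iio r)).mpr fun i _ => hb i
  obtain ⟨K, hK⟩ := Filter.eventually_atTop.mp hall
  refine ⟨K, sInf {s : ℕ | ∀ i, s ≤ i → i < r → b i}, fun k hk => ?_⟩
  rw [artinReesNumber_eq_sInf]
  congr 1
  ext s
  simp only [Set.mem_ofPred_eq, hiff]
  refine forall₂_congr fun i _ => ?_
  by_cases hir : i < r
  · simpa [hir] using hK k hk i hir
  · exact iff_of_true (fun x hx _ => hr i (not_lt.mp hir) hx) fun h => absurd h hir
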